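/- With the standard type A_θ hypotheses on (q_{st}) and the listed relations holding in the ℤ^θ-graded algebra B: for all indices with 1 ≤ i < p ≤ r < j ≤ θ one has [x_{u_{ir}}, x_{u_{pj}}]_c = χ(u_{ir}, u_{pr}) · (1 − q_{r,r+1}q_{r+1,r}) · x_{u_{pr}} x_{u_{ij}}. -/

import Mathlib

/-- The degree `e_i ∈ ℤ^θ` of the generator `x_i` (indices are 1-based, degrees are
modeled as finitely supported-looking functions `ℕ → ℤ`). -/
def evec (i : ℕ) : ℕ → ℤ := fun t => if t = i then 1 else 0

/-- The degree `u_{ij} = e_i + e_{i+1} + ⋯ + e_j ∈ ℤ^θ`. -/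
def uvec (i j : ℕ) : ℕ → ℤ := fun t => if i ≤ t ∧ t ≤ j then 1 else 0

/-- Braided commutator of (homogeneous) elements `u, v` of degrees `α, β`:
`[u, v]_c = uv − χ(α, β) vu`. -/
def bra {k : Type*} [Field k] {B : Type*} [Ring B] [Algebra k B]
    (χ : (ℕ → ℤ) → (ℕ → ℤ) → k) (α : ℕ → ℤ) (u : B) (β : ℕ → ℤ) (v : B) : B :=
  u * v - χ α β • (v * u)

/-- The iterated root vector `x_{u_{ij}}`, defined by `x_{u_{ii}} = x_i` and
`x_{u_{ij}} = [x_i, x_{u_{i+1,j}}]_c` for `i < j`. -/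
def xu {k : Type*} [Field k] {B : Type*} [Ring B] [Algebra k B]
    (χ : (ℕ → ℤ) → (ℕ → ℤ) → k) (x : ℕ → B) (i j : ℕ) : B :=
  if h : j ≤ i then x i
  else bra χ (evec i) (x i) (uvec (i + 1) j) (xu χ x (i + 1) j)
termination_by j - i
decreasing_by omega

def CommC {k : Type*} [Field k] {B : Type*} [Ring B] [Algebra k B]
    (χ : (ℕ → ℤ) → (ℕ → ℤ) → k) (α : ℕ → ℤ) (u : B) (β : ℕ → ℤ) (v : B) : Prop :=
  u * v = χ α β • (v * u)

theorem uvec_self (i : ℕ) : uvec i i = evec i := by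
  funext t; simp only [uvec, evec]; congr 1; apply propext; omega

theorem uvec_split (i r j : ℕ) (h : i ≤ r) (h2 : r < j) :
    uvec i j = uvec i r + uvec (r + 1) j := by
  funext t; simp only [uvec, Pi.add_apply]; split_ifs <;> omega

theorem uvec_cons (i j : ℕ) (h : i < j) : uvec i j = evec i + uvec (i + 1) j := by
  rw [uvec_split i i j le_rfl h, uvec_self]

section aux
variable {k : Type*} [Field k] {B : Type*} [Ring B] [Algebra k B]
    (χ : (ℕ → ℤ) → (ℕ → ℤ) → k)

theorem bra_eq_zero_iff (α : ℕ → ℤ) (u : B) (β : ℕ → ℤ) (v : B) :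
    bra χ α u β v = 0 ↔ CommC χ α u β v := by
  simp only [bra, CommC, sub_eq_zero]

theorem comm_bra_left (hχ₁ : ∀ a b c, χ (a + b) c = χ a c * χ b c)
    (α γ β : ℕ → ℤ) (u v w : B) (hu : CommC χ α u β w) (hv : CommC χ γ v β w) :
    CommC χ (α + γ) (bra χ α u γ v) β w := by
  unfold CommC at *
  have hu' : ∀ z, u * (w * z) = χ α β • (w * (u * z)) := fun z => by
    rw [← mul_assoc, hu, smul_mul_assoc, mul_assoc]
  have hv' : ∀ z, v * (w * z) = χ γ β • (w * (v * z)) := fun z => by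
    rw [← mul_assoc, hv, smul_mul_assoc, mul_assoc]
  simp only [bra, hχ₁, sub_mul, mul_sub, smul_mul_assoc, mul_assoc, hu, hv, hu', hv',
    mul_smul_comm]
  module

theorem comm_bra_right (hχ₂ : ∀ a b c, χ a (b + c) = χ a b * χ a c)
    (α γ β : ℕ → ℤ) (u v w : B) (hu : CommC χ β w α u) (hv : CommC χ β w γ v) :
    CommC χ β w (α + γ) (bra χ α u γ v) := by
  unfold CommC at *
  have hu' : ∀ z, w * (u * z) = χ β α • (u * (w * z)) := fun z => by
    rw [← mul_assoc, hu, smul_mul_assoc, mul_assoc]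
  have hv' : ∀ z, w * (v * z) = χ β γ • (v * (w * z)) := fun z => by
    rw [← mul_assoc, hv, smul_mul_assoc, mul_assoc]
  simp only [bra, hχ₂, sub_mul, mul_sub, smul_mul_assoc, mul_assoc, hu, hv, hu', hv',
    mul_smul_comm]
  module

theorem bra_assoc (hχ₁ : ∀ a b c, χ (a + b) c = χ a c * χ b c)
    (hχ₂ : ∀ a b c, χ a (b + c) = χ a b * χ a c)
    (α γ β : ℕ → ℤ) (u v w : B) (hu : CommC χ α u β w) :
    bra χ α u (γ + β) (bra χ γ v β w) = bra χ (α + γ) (bra χ α u γ v) β w := by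
  unfold CommC at *
  have hu' : ∀ z, u * (w * z) = χ α β • (w * (u * z)) := fun z => by
    rw [← mul_assoc, hu, smul_mul_assoc, mul_assoc]
  simp only [bra, hχ₁, hχ₂, sub_mul, mul_sub, smul_mul_assoc, mul_assoc, hu, hu',
    mul_smul_comm]
  module

theorem main_comp (hχ₁ : ∀ a b c, χ (a + b) c = χ a c * χ b c)
    (hχ₂ : ∀ a b c, χ a (b + c) = χ a b * χ a c)
    (α γ β : ℕ → ℤ) (u v w : B) (huv : CommC χ α u γ v)
    (hz : CommC χ (α + β) (bra χ α u β w) γ v) :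
    bra χ α u (γ + β) (bra χ γ v β w)
      = (χ α γ * (1 - χ γ β * χ β γ)) • (v * bra χ α u β w) := by
  have h1 : bra χ α u (γ + β) (bra χ γ v β w)
      = χ α γ • (v * bra χ α u β w) - χ γ β • (bra χ α u β w * v) := by
    unfold CommC at huv
    have hu' : ∀ z, u * (v * z) = χ α γ • (v * (u * z)) := fun z => by
      rw [← mul_assoc, huv, smul_mul_assoc, mul_assoc]
    simp only [bra, hχ₁, hχ₂, sub_mul, mul_sub, smul_mul_assoc, mul_assoc, huv, hu',
      mul_smul_comm]
    module
  unfold CommC at hz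
  rw [h1, hz, hχ₁]
  module

theorem xu_self (x : ℕ → B) (i : ℕ) : xu χ x i i = x i := by
  rw [xu]; simp

theorem xu_cons (x : ℕ → B) (i j : ℕ) (h : i < j) :
    xu χ x i j = bra χ (evec i) (x i) (uvec (i + 1) j) (xu χ x (i + 1) j) := by
  rw [xu, dif_neg (by omega)]

theorem commL (hχ₁ : ∀ a b c, χ (a + b) c = χ a c * χ b c) (x : ℕ → B)
    (β : ℕ → ℤ) (w : B) (n : ℕ) : ∀ a b, b = a + n →
    (∀ s, a ≤ s → s ≤ b → CommC χ (evec s) (x s) β w) →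
    CommC χ (uvec a b) (xu χ x a b) β w := by
  induction n with
  | zero =>
    intro a b h H
    obtain rfl : b = a := by omega
    rw [uvec_self, xu_self]; exact H _ le_rfl le_rfl
  | succ n ih =>
    intro a b h H
    rw [uvec_cons a b (by omega), xu_cons χ x a b (by omega)]
    exact comm_bra_left χ hχ₁ _ _ _ _ _ _ (H a le_rfl (by omega))
      (ih (a + 1) b (by omega) fun s h1 h2 => H s (by omega) h2)

theorem commR (hχ₂ : ∀ a b c, χ a (b + c) = χ a b * χ a c) (x : ℕ → B)
    (β : ℕ → ℤ) (w : B) (n : ℕ) : ∀ a b, b = a + n →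
    (∀ s, a ≤ s → s ≤ b → CommC χ β w (evec s) (x s)) →
    CommC χ β w (uvec a b) (xu χ x a b) := by
  induction n with
  | zero =>
    intro a b h H
    obtain rfl : b = a := by omega
    rw [uvec_self, xu_self]; exact H _ le_rfl le_rfl
  | succ n ih =>
    intro a b h H
    rw [uvec_cons a b (by omega), xu_cons χ x a b (by omega)]
    exact comm_bra_right χ hχ₂ _ _ _ _ _ _ (H a le_rfl (by omega))
      (ih (a + 1) b (by omega) fun s h1 h2 => H s (by omega) h2)

theorem symM (hχ₁ : ∀ a b c, χ (a + b) c = χ a c * χ b c)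
    (hχ₂ : ∀ a b c, χ a (b + c) = χ a b * χ a c)
    (β : ℕ → ℤ) (n : ℕ) : ∀ a b, b = a + n →
    (∀ s, a ≤ s → s ≤ b → χ (evec s) β * χ β (evec s) = 1) →
    χ (uvec a b) β * χ β (uvec a b) = 1 := by
  induction n with
  | zero =>
    intro a b h H
    obtain rfl : b = a := by omega
    rw [uvec_self]; exact H _ le_rfl le_rfl
  | succ n ih =>
    intro a b h H
    rw [uvec_cons a b (by omega), hχ₁, hχ₂]
    have h1 := H a le_rfl (by omega)
    have h2 := ih (a + 1) b (by omega) fun s h1 h2 => H s (by omega) h2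
    linear_combination h1 * (χ (uvec (a + 1) b) β * χ β (uvec (a + 1) b)) + h2

theorem xu_split (hχ₁ : ∀ a b c, χ (a + b) c = χ a c * χ b c)
    (hχ₂ : ∀ a b c, χ a (b + c) = χ a b * χ a c) (x : ℕ → B) (θ : ℕ)
    (hfarc : ∀ i j, 1 ≤ i → i ≤ θ → 1 ≤ j → j ≤ θ → (i + 1 < j ∨ j + 1 < i) →
      CommC χ (evec i) (x i) (evec j) (x j)) (n : ℕ) :
    ∀ i r j, r = i + n → 1 ≤ i → r < j → j ≤ θ →
    xu χ x i j = bra χ (uvec i r) (xu χ x i r) (uvec (r + 1) j) (xu χ x (r + 1) j) := by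
  induction n with
  | zero =>
    intro i r j h h1 h2 h3
    obtain rfl : r = i := by omega
    rw [xu_cons χ x r j h2, uvec_self, xu_self]
  | succ n ih =>
    intro i r j h h1 h2 h3
    rw [xu_cons χ x i j (by omega), ih (i + 1) r j (by omega) (by omega) h2 h3,
      uvec_split (i + 1) r j (by omega) h2, bra_assoc χ hχ₁ hχ₂,
      ← xu_cons χ x i r (by omega), ← uvec_cons i r (by omega)]
    exact commR χ hχ₂ x _ _ (j - (r + 1)) _ _ (by omega)
      fun s _ _ => hfarc _ _ (by omega) (by omega) (by omega) (by omega) (by omega)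

end aux

/-- Lemma: `[x_{u_{ir}}, x_{u_{pj}}]_c = χ(u_{ir}, u_{pr})(1 − q_{r,r+1} q_{r+1,r}) x_{u_{pr}} x_{u_{ij}}`
for `i < p ≤ r < j`. -/
theorem stmt_8 {k : Type*} [Field k] {B : Type*} [Ring B] [Algebra k B]
    -- the braiding matrix, of standard type A_θ
    (θ : ℕ) (hθ : 2 ≤ θ) (q : ℕ → ℕ → k) (q0 : k) (hq00 : q0 ≠ 0) (hq01 : q0 ≠ 1)
    (hq : ∀ s t, 1 ≤ s → s ≤ θ → 1 ≤ t → t ≤ θ → q s t ≠ 0)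
    (hfar : ∀ s t, 1 ≤ s → s ≤ θ → 1 ≤ t → t ≤ θ → (s + 1 < t ∨ t + 1 < s) →
      q s t * q t s = 1)
    (hadjt : ∀ s, 1 ≤ s → s + 1 ≤ θ →
      q s (s + 1) * q (s + 1) s = q0 ∨ q s (s + 1) * q (s + 1) s = q0⁻¹)
    (hdiag : ∀ s, 1 ≤ s → s ≤ θ →
      (q s s = -1 ∧ (1 < s → s < θ →
          (q (s - 1) s * q s (s - 1)) * (q s (s + 1) * q (s + 1) s) = 1)) ∨
      (q s s ≠ -1 ∧ (q s s = q0 ∨ q s s = q0⁻¹) ∧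
        (s < θ → q s s * (q s (s + 1) * q (s + 1) s) = 1) ∧
        (1 < s → q s s * (q (s - 1) s * q s (s - 1)) = 1)))
    -- the associated bicharacter
    (χ : (ℕ → ℤ) → (ℕ → ℤ) → k)
    (hχ₁ : ∀ a b c, χ (a + b) c = χ a c * χ b c)
    (hχ₂ : ∀ a b c, χ a (b + c) = χ a b * χ a c)
    (hχq : ∀ s t, 1 ≤ s → s ≤ θ → 1 ≤ t → t ≤ θ → χ (evec s) (evec t) = q s t)
    -- the ℤ^θ-graded algebra B with its generators x_i of degree e_i
    (x : ℕ → B) (𝒜 : (ℕ → ℤ) → Submodule k B)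
    (hgr : ∀ (α β : ℕ → ℤ) (a b : B), a ∈ 𝒜 α → b ∈ 𝒜 β → a * b ∈ 𝒜 (α + β))
    (hxdeg : ∀ i, 1 ≤ i → i ≤ θ → x i ∈ 𝒜 (evec i))
    -- the relations assumed to hold in B
    (hnil : ∀ i, 1 ≤ i → i ≤ θ → q i i = -1 → x i ^ 2 = 0)
    (hrel1 : ∀ i j, 1 ≤ i → i ≤ θ → 1 ≤ j → j ≤ θ → (i + 1 < j ∨ j + 1 < i) →
      bra χ (evec i) (x i) (evec j) (x j) = 0)
    (hrel2 : ∀ i j, 1 ≤ i → i ≤ θ → 1 ≤ j → j ≤ θ → (i + 1 = j ∨ j + 1 = i) →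
      bra χ (evec i) (x i) (evec i + evec j) (bra χ (evec i) (x i) (evec j) (x j)) = 0)
    (hrel3 : ∀ i, 1 ≤ i → i + 2 ≤ θ →
      bra χ (evec i + (evec (i + 1) + evec (i + 2)))
        (bra χ (evec i) (x i) (evec (i + 1) + evec (i + 2))
          (bra χ (evec (i + 1)) (x (i + 1)) (evec (i + 2)) (x (i + 2))))
        (evec (i + 1)) (x (i + 1)) = 0) :
    ∀ i p r j, 1 ≤ i → i < p → p ≤ r → r < j → j ≤ θ →
      bra χ (uvec i r) (xu χ x i r) (uvec p j) (xu χ x p j)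
        = (χ (uvec i r) (uvec p r) * (1 - q r (r + 1) * q (r + 1) r)) •
            (xu χ x p r * xu χ x i j) := by
  have hfarc : ∀ i j, 1 ≤ i → i ≤ θ → 1 ≤ j → j ≤ θ → (i + 1 < j ∨ j + 1 < i) →
      CommC χ (evec i) (x i) (evec j) (x j) := fun i j h1 h2 h3 h4 h5 =>
    (bra_eq_zero_iff χ _ _ _ _).1 (hrel1 i j h1 h2 h3 h4 h5)
  have hsplit : ∀ i r j, 1 ≤ i → i ≤ r → r < j → j ≤ θ →
      xu χ x i j = bra χ (uvec i r) (xu χ x i r) (uvec (r + 1) j) (xu χ x (r + 1) j) :=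
    fun i r j h1 h2 h3 h4 =>
      xu_split χ hχ₁ hχ₂ x θ hfarc (r - i) i r j (by omega) h1 h3 h4
  -- two letters
  have hpair : ∀ s, 1 ≤ s → s + 1 ≤ θ →
      CommC χ (uvec s (s + 1)) (xu χ x s (s + 1)) (evec (s + 1)) (x (s + 1)) := by
    intro s h1 h2
    rw [xu_cons χ x s (s + 1) (by omega), uvec_cons s (s + 1) (by omega), uvec_self, xu_self]
    have e12 := hχq s (s + 1) h1 (by omega) (by omega) h2
    have e21 := hχq (s + 1) s (by omega) h2 h1 (by omega)
    have e22 := hχq (s + 1) (s + 1) (by omega) h2 (by omega) h2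
    rcases hdiag (s + 1) (by omega) h2 with ⟨hm, -⟩ | ⟨-, -, -, hh⟩
    · have h0 : x (s + 1) * x (s + 1) = 0 := by
        rw [← sq]; exact hnil (s + 1) (by omega) h2 hm
      have h0' : ∀ z, x (s + 1) * (x (s + 1) * z) = 0 := fun z => by
        rw [← mul_assoc, h0, zero_mul]
      simp only [CommC, bra, hχ₁, e12, e22, hm, sub_mul, mul_sub, smul_mul_assoc, mul_assoc,
        mul_smul_comm, h0, h0', mul_zero, smul_zero]
      module
    · have hh := hh (by omega)
      simp only [Nat.add_sub_cancel] at hh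
      have hr := hrel2 (s + 1) s (by omega) h2 h1 (by omega) (by omega)
      have n21 := hq (s + 1) s (by omega) h2 h1 (by omega)
      have n22 := hq (s + 1) (s + 1) (by omega) h2 (by omega) h2
      have n12 := hq s (s + 1) h1 (by omega) (by omega) h2
      simp only [CommC, bra, hχ₁, hχ₂, e12, e21, e22, sub_mul, mul_sub, smul_mul_assoc,
        mul_assoc, mul_smul_comm] at hr ⊢
      generalize q s (s + 1) = a at *
      generalize q (s + 1) s = b at *
      generalize q (s + 1) (s + 1) = c at *
      have hc : c = (a * b)⁻¹ := by
        field_simp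
        linear_combination hh
      subst hc
      rw [← sub_eq_zero]
      have := congrArg (fun z => (a * b⁻¹) • z) hr
      simp only [smul_zero] at this
      rw [← this]
      match_scalars <;> field_simp <;> ring
  have htriple : ∀ s, 1 ≤ s → s + 2 ≤ θ →
      CommC χ (uvec s (s + 2)) (xu χ x s (s + 2)) (evec (s + 1)) (x (s + 1)) := by
    intro s h1 h2
    have := (bra_eq_zero_iff χ _ _ _ _).1 (hrel3 s h1 h2)
    rw [xu_cons χ x s (s + 2) (by omega), uvec_cons s (s + 2) (by omega),
      xu_cons χ x (s + 1) (s + 2) (by omega), uvec_cons (s + 1) (s + 2) (by omega),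
      uvec_self, xu_self]
    exact this
  have hleft : ∀ i m j s, 1 ≤ i → i ≤ m → m + 1 < s → s ≤ j → j ≤ θ →
      CommC χ (uvec (m + 1) j) (xu χ x (m + 1) j) (evec s) (x s) →
      CommC χ (uvec i j) (xu χ x i j) (evec s) (x s) := by
    intro i m j s h1 h2 h3 h4 h5 H
    rw [hsplit i m j h1 h2 (by omega) h5, uvec_split i m j h2 (by omega)]
    refine comm_bra_left χ hχ₁ _ _ _ _ _ _ ?_ H
    exact commL χ hχ₁ x _ _ (m - i) _ _ (by omega)
      fun t _ _ => hfarc _ _ (by omega) (by omega) (by omega) (by omega) (by omega)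
  have hC : ∀ i j s, 1 ≤ i → i < s → s ≤ j → j ≤ θ →
      CommC χ (uvec i j) (xu χ x i j) (evec s) (x s) := by
    intro i j s h1 h2 h3 h4
    have key : ∀ t, s = t + 1 → 1 ≤ t →
        CommC χ (uvec t j) (xu χ x t j) (evec s) (x s) := by
      rintro t rfl ht
      rcases Nat.lt_or_ge (t + 1) j with hj | hj
      · rcases Nat.lt_or_ge (t + 2) j with hj2 | hj2
        · rw [hsplit t (t + 2) j ht (by omega) hj2 h4, uvec_split t (t + 2) j (by omega) hj2]
          refine comm_bra_left χ hχ₁ _ _ _ _ _ _ (htriple t ht (by omega)) ?_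
          exact commL χ hχ₁ x _ _ (j - (t + 2 + 1)) _ _ (by omega)
            fun t _ _ => hfarc _ _ (by omega) (by omega) (by omega) (by omega) (by omega)
        · obtain rfl : j = t + 2 := by omega
          exact htriple t ht h4
      · obtain rfl : j = t + 1 := by omega
        exact hpair t ht h4
    rcases Nat.lt_or_ge (i + 1) s with hs | hs
    · obtain ⟨m, rfl⟩ : ∃ m, s = m + 1 + 1 := ⟨s - 2, by omega⟩
      exact hleft i m j _ h1 (by omega) (by omega) h3 h4 (key (m + 1) rfl (by omega))
    · exact key i (by omega) h1
  intro i p r j hi hip hpr hrj hj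
  have hz : ∀ b, r ≤ b → b ≤ θ →
      CommC χ (uvec i b) (xu χ x i b) (uvec p r) (xu χ x p r) := fun b hb hb' =>
    commR χ hχ₂ x _ _ (r - p) _ _ (by omega)
      fun s _ _ => hC _ _ _ hi (by omega) (by omega) hb'
  have hM : χ (uvec p r) (uvec (r + 1) j) * χ (uvec (r + 1) j) (uvec p r)
      = q r (r + 1) * q (r + 1) r := by
    have f1 : ∀ s t, 1 ≤ s → s + 1 < t → t ≤ θ →
        χ (evec s) (evec t) * χ (evec t) (evec s) = 1 := by
      intro s t h1 h2 h3
      rw [hχq _ _ h1 (by omega) (by omega) h3, hχq _ _ (by omega) h3 h1 (by omega)]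
      exact hfar _ _ h1 (by omega) (by omega) h3 (by omega)
    have f2 : χ (evec r) (uvec (r + 1) j) * χ (uvec (r + 1) j) (evec r)
        = q r (r + 1) * q (r + 1) r := by
      rw [← hχq r (r + 1) (by omega) (by omega) (by omega) (by omega),
        ← hχq (r + 1) r (by omega) (by omega) (by omega) (by omega)]
      rcases Nat.lt_or_ge (r + 1) j with h | h
      · rw [uvec_cons (r + 1) j h, hχ₁, hχ₂]
        have := symM χ hχ₁ hχ₂ (evec r) (j - (r + 1 + 1)) (r + 1 + 1) j (by omega)
          fun s h1 h2 => by
            rw [mul_comm]; exact f1 r s (by omega) (by omega) (by omega)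
        linear_combination this * (χ (evec r) (evec (r + 1)) * χ (evec (r + 1)) (evec r))
      · obtain rfl : j = r + 1 := by omega
        rw [uvec_self]
    rcases Nat.lt_or_ge p r with h | h
    · obtain ⟨m, rfl⟩ : ∃ m, r = m + 1 := ⟨r - 1, by omega⟩
      rw [uvec_split p m (m + 1) (by omega) (by omega), uvec_self, hχ₁, hχ₂]
      have := symM χ hχ₁ hχ₂ (uvec (m + 1 + 1) j) (m - p) p m (by omega)
        fun s h1 h2 => by
          have := symM χ hχ₁ hχ₂ (evec s) (j - (m + 1 + 1)) (m + 1 + 1) j (by omega)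
            fun t h1 h2 => by
              rw [mul_comm]; exact f1 s t (by omega) (by omega) (by omega)
          rw [mul_comm]; exact this
      rw [← f2]
      linear_combination this *
        (χ (evec (m + 1)) (uvec (m + 1 + 1) j) * χ (uvec (m + 1 + 1) j) (evec (m + 1)))
    · obtain rfl : p = r := by omega
      rw [uvec_self]; exact f2
  rw [← hM, hsplit p r j (by omega) hpr hrj hj, uvec_split p r j hpr hrj,
    hsplit i r j hi (by omega) hrj hj]
  refine main_comp χ hχ₁ hχ₂ _ _ _ _ _ _ (hz r le_rfl (by omega)) ?_
  rw [← hsplit i r j hi (by omega) hrj hj, ← uvec_split i r j (by omega) hrj]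
  exact hz j hrj.le hj
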